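/- Let 3 ≤ i ≤ m and let p = (p₁, …, p_m) be a semi-normalized m-tuple in ℍ^{n+1}. Let λ₁, …, λ_m be nonzero quaternions. Then (p₁λ₁, …, p_mλ_m) is again semi-normalized if and only if λ₁ = λ₂ = ⋯ = λ_m and |λ₁| = 1. -/

import Mathlib

noncomputable section

open Quaternion Matrix
open scoped Classical

abbrev ℍq : Type := Quaternion ℝ

/-- Hermitian form matrix of signature (n,1). -/
def qHmat (n : ℕ) : Matrix (Fin (n+1)) (Fin (n+1)) ℍq := fun k j =>
  if (k = 0 ∧ j = Fin.last n) ∨ (k = Fin.last n ∧ j = 0) then 1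
  else if k = j ∧ k ≠ 0 ∧ k ≠ Fin.last n then 1 else 0

/-- `herm n z w = ⟨z,w⟩ = w* H z`. -/
def herm (n : ℕ) (z w : Fin (n+1) → ℍq) : ℍq :=
  ∑ k, ∑ j, star (w k) * qHmat n k j * z j

/-- Two `m`-tuples of vectors are PSp(n,1)-congruent if some `C ∈ Sp(n,1)` carries each
`p k` to `q k` up to a nonzero right quaternionic scalar. -/
def PSpCongruent (n m : ℕ) (p q : Fin m → Fin (n+1) → ℍq) : Prop :=
  ∃ C : Matrix (Fin (n+1)) (Fin (n+1)) ℍq, Cᴴ * qHmat n * C = qHmat n ∧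
    ∃ μ : Fin m → ℍq, (∀ k, μ k ≠ 0) ∧ ∀ k, C.mulVec (p k) = fun j => q k j * μ k

/-- An `m`-tuple `p` (first `i` entries null, the rest negative, pairwise projectively
distinct) is semi-normalized if its Gram matrix `g_{kj} = ⟨p_j, p_k⟩` satisfies
`g_{kk} = 0` for `1 ≤ k ≤ i`, `|g_{23}| = 1`, `g_{1j} = 1` for `2 ≤ j ≤ i`,
`g_{kk} = −1` for `i+1 ≤ k ≤ m`, and `g_{1j}` positive real for `i+1 ≤ j ≤ m`
(1-based indexing). -/
def SemiNormalized (n m i : ℕ) (p : Fin m → Fin (n+1) → ℍq) : Prop :=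
  (∀ k, p k ≠ 0) ∧
  (∀ k l : Fin m, k ≠ l → ∀ c : ℍq, p k ≠ fun j => p l j * c) ∧
  (∀ k : Fin m, (k : ℕ) < i → herm n (p k) (p k) = 0) ∧
  (∀ k j : Fin m, (k : ℕ) = 1 → (j : ℕ) = 2 → ‖herm n (p j) (p k)‖ = 1) ∧
  (∀ k j : Fin m, (k : ℕ) = 0 → 1 ≤ (j : ℕ) → (j : ℕ) < i → herm n (p j) (p k) = 1) ∧
  (∀ k : Fin m, i ≤ (k : ℕ) → herm n (p k) (p k) = -1) ∧
  (∀ k j : Fin m, (k : ℕ) = 0 → i ≤ (j : ℕ) → ∃ r : ℝ, 0 < r ∧ herm n (p j) (p k) = (r : ℍq))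

/-- The Korányi–Reimann quaternionic cross ratio. -/
def crossRatio (n : ℕ) (z1 z2 z3 z4 : Fin (n+1) → ℍq) : ℍq :=
  herm n z3 z1 * (herm n z3 z2)⁻¹ * herm n z4 z2 * (herm n z4 z1)⁻¹

/-- The quaternionic Cartan angular invariant
`𝔸(z₁,z₂,z₃) = arccos(Re(−T)/|T|)` with `T = ⟨z₁,z₂⟩⟨z₂,z₃⟩⟨z₃,z₁⟩`. -/
def angInv (n : ℕ) (z1 z2 z3 : Fin (n+1) → ℍq) : ℝ :=
  Real.arccos ((-(herm n z1 z2 * herm n z2 z3 * herm n z3 z1)).re /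
    ‖herm n z1 z2 * herm n z2 z3 * herm n z3 z1‖)

/-- The rotation invariant `u(g) = Im g / |Im g|` (and `0` if `Im g = 0`). -/
def rotInv (g : ℍq) : ℍq := if g.im = 0 then 0 else (‖g.im‖)⁻¹ • g.im

/-- The distance invariant `d(z,w) = (⟨w,z⟩·⟨z,w⟩)/(⟨w,w⟩·⟨z,z⟩)`. -/
def dInv (n : ℕ) (z w : Fin (n+1) → ℍq) : ℍq :=
  (herm n w z * herm n z w) / (herm n w w * herm n z z)

/-- The Hermitian form is sesquilinear with respect to right scalar multiplication. -/
lemma herm_mul_right (n : ℕ) (z w : Fin (n+1) → ℍq) (a b : ℍq) :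
    herm n (fun j => z j * a) (fun j => w j * b) = star b * herm n z w * a := by
  simp only [herm, star_mul, Finset.mul_sum, Finset.sum_mul, mul_assoc]

lemma star_mul_self_eq_one {a : ℍq} (ha : ‖a‖ = 1) : star a * a = 1 := by
  rw [Quaternion.star_mul_self, Quaternion.normSq_eq_norm_mul_self, ha]
  simp

/-- Unit quaternions `a`, `b` with `star a * b` a positive real are equal. -/
lemma eq_of_star_mul_eq_coe {a b : ℍq} (ha : ‖a‖ = 1) (hb : ‖b‖ = 1) {s : ℝ} (hs : 0 < s)
    (h : star a * b = (s : ℍq)) : a = b := by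
  have hs1 : s = 1 := by
    have := congrArg norm h
    rw [norm_mul, norm_star, ha, hb, Quaternion.norm_coe, Real.norm_of_nonneg hs.le] at this
    linarith
  have ha0 : star a ≠ 0 := by
    rw [← norm_ne_zero_iff, norm_star, ha]
    exact one_ne_zero
  apply mul_left_cancel₀ ha0
  rw [h, star_mul_self_eq_one ha, hs1, Quaternion.coe_one]

/-- **Rescalings preserving semi-normalization.** If `p` is a semi-normalized `m`-tuple
(`3 ≤ i ≤ m`) and `λ₁, …, λ_m` are nonzero quaternions, then `(p₁λ₁, …, p_mλ_m)` is
again semi-normalized if and only if all the `λ_k` are equal and of norm one. -/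
theorem semi_normalized_rescale_iff (n m i : ℕ) (hi : 3 ≤ i) (him : i ≤ m)
    (p : Fin m → Fin (n+1) → ℍq) (hp : SemiNormalized n m i p)
    (lam : Fin m → ℍq) (hlam : ∀ k, lam k ≠ 0) :
    SemiNormalized n m i (fun k j => p k j * lam k) ↔
      (∀ k l : Fin m, lam k = lam l) ∧ ‖lam ⟨0, by omega⟩‖ = 1 := by
  obtain ⟨hne, hdist, hnull, hunit, hone, hneg, hpos⟩ := hp
  constructor
  · rintro ⟨-, -, -, hunit', hone', hneg', hpos'⟩
    simp only [herm_mul_right] at hunit' hone' hneg' hpos'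
    set o : Fin m := ⟨0, by omega⟩
    have hstar : ∀ j : Fin m, 1 ≤ (j : ℕ) → (j : ℕ) < i → star (lam o) * lam j = 1 := by
      intro j h1 h2
      simpa [hone o j rfl h1 h2] using hone' o j rfl h1 h2
    have hnorm_mul : ∀ j : Fin m, 1 ≤ (j : ℕ) → (j : ℕ) < i → ‖lam o‖ * ‖lam j‖ = 1 := by
      intro j h1 h2
      simpa using congrArg norm (hstar j h1 h2)
    have h1 := hnorm_mul ⟨1, by omega⟩ le_rfl (by simp; omega)
    have h2 := hnorm_mul ⟨2, by omega⟩ (by simp) (by simp; omega)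
    have h12 := hunit' ⟨1, by omega⟩ ⟨2, by omega⟩ rfl rfl
    rw [norm_mul, norm_mul, norm_star, hunit _ _ rfl rfl, mul_one] at h12
    have hsq : ‖lam o‖ * ‖lam o‖ = 1 := by
      linear_combination ‖lam o‖ * ‖lam ⟨2, by omega⟩‖ * h1 + h2 - ‖lam o‖ * ‖lam o‖ * h12
    have ho : ‖lam o‖ = 1 := by nlinarith [norm_nonneg (lam o)]
    have heq : ∀ j : Fin m, lam o = lam j := by
      intro j
      rcases Nat.eq_zero_or_pos (j : ℕ) with hj0 | hj0
      · exact congrArg lam (Fin.ext hj0.symm)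
      rcases lt_or_ge (j : ℕ) i with hji | hji
      · have hj : ‖lam j‖ = 1 := by simpa [ho] using hnorm_mul j hj0 hji
        exact eq_of_star_mul_eq_coe ho hj one_pos (by simpa using hstar j hj0 hji)
      · have hj : ‖lam j‖ = 1 := by
          have := congrArg norm (hneg' j hji)
          rw [hneg j hji] at this
          simp only [norm_mul, norm_star, norm_neg, norm_one, mul_one] at this
          nlinarith [norm_nonneg (lam j)]
        obtain ⟨r, hr, hr'⟩ := hpos o j rfl hji
        obtain ⟨s, hs, hs'⟩ := hpos' o j rfl hji
        refine eq_of_star_mul_eq_coe ho hj (div_pos hs hr) ?_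
        rw [hr', ← Quaternion.coe_commutes, mul_assoc] at hs'
        have hr0 : (r : ℍq) ≠ 0 := by rw [← norm_ne_zero_iff, Quaternion.norm_coe]; exact norm_ne_zero_iff.mpr hr.ne'
        apply mul_left_cancel₀ hr0
        rw [hs', ← Quaternion.coe_mul, mul_div_cancel₀ _ hr.ne']
    exact ⟨fun k l => (heq k).symm.trans (heq l), ho⟩
  · rintro ⟨heq, hnorm⟩
    obtain ⟨c, hc⟩ : ∃ c, c = lam ⟨0, by omega⟩ := ⟨_, rfl⟩
    have hl : ∀ k, lam k = c := fun k => (heq k _).trans hc.symm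
    rw [← hc] at hnorm
    have hcc := star_mul_self_eq_one hnorm
    have hc0 : c ≠ 0 := hc ▸ hlam _
    simp only [SemiNormalized, herm_mul_right, hl]
    refine ⟨?_, ?_, ?_, ?_, ?_, ?_, ?_⟩
    · intro k hk
      exact hne k (funext fun j => (mul_eq_zero.mp (congrFun hk j)).resolve_right hc0)
    · intro k l hkl d hd
      refine hdist k l hkl (c * d * c⁻¹) (funext fun j => ?_)
      rw [← mul_assoc, ← mul_assoc, ← congrFun hd j, mul_inv_cancel_right₀ hc0]
    · intro k hk
      simp [hnull k hk]
    · intro k j hk hj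
      simp [hunit k j hk hj, hnorm]
    · intro k j hk h1 h2
      simp [hone k j hk h1 h2, hcc]
    · intro k hk
      simp [hneg k hk, hcc]
    · intro k j hk hj
      obtain ⟨r, hr, hr'⟩ := hpos k j hk hj
      exact ⟨r, hr, by rw [hr', ← Quaternion.coe_commutes, mul_assoc, hcc, mul_one]⟩
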